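/- Let q be a complex number with 0 < |q| < 1 and let a be a complex number such that (a²q²;q²)_m ≠ 0 for all m ≥ 0 and (aq;q)_m ≠ 0 for all m ≥ 0. Suppose (α_n, β_n)_{n ≥ 0} is a Bailey pair with parameters (a², q²). Define α'_n = α_n for all n ≥ 0 and β'_n = ∑_{r=0}^{n} (−aq;q)_{2r} q^{n−r} β_r / (q²;q²)_{n−r} for all n ≥ 0. Then (α'_n, β'_n)_{n ≥ 0} is a Bailey pair with parameters (a, q). -/

import Mathlib

open Finset

/-- Finite q-Pochhammer symbol `(x;q)_n`. -/
noncomputable def qPoch (q x : ℂ) (n : ℕ) : ℂ :=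
  ∏ j ∈ Finset.range n, (1 - x * q ^ j)

/-- `(α, β)` is a Bailey pair with parameters `(a, q)` if
`β_n = ∑_{r=0}^n α_r / ((q;q)_{n-r} (aq;q)_{n+r})` for all `n ≥ 0`. -/
def IsBaileyPair (q a : ℂ) (α β : ℕ → ℂ) : Prop :=
  ∀ n : ℕ, β n = ∑ r ∈ Finset.range (n + 1),
    α r / (qPoch q q (n - r) * qPoch q (a * q) (n + r))

lemma qPoch_succ (q x : ℂ) (n : ℕ) : qPoch q x (n + 1) = qPoch q x n * (1 - x * q ^ n) :=
  prod_range_succ _ _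

lemma qPoch_add (q x : ℂ) (m n : ℕ) :
    qPoch q x (m + n) = qPoch q x m * qPoch q (x * q ^ m) n := by
  simp only [qPoch, prod_range_add, pow_add, mul_assoc]

lemma qPoch_sq (q x : ℂ) (n : ℕ) :
    qPoch (q ^ 2) (x ^ 2) n = qPoch q x n * qPoch q (-x) n := by
  simp only [qPoch, ← prod_mul_distrib]
  exact prod_congr rfl fun j _ => by ring

lemma one_sub_pow_ne_zero {q : ℂ} (hq1 : ‖q‖ < 1) {n : ℕ} (hn : n ≠ 0) : 1 - q ^ n ≠ 0 := by
  intro h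
  have h1 : ‖q ^ n‖ = 1 := by rw [← sub_eq_zero.mp h, norm_one]
  rw [norm_pow] at h1
  exact (pow_lt_one₀ (norm_nonneg q) hq1 hn).ne h1

lemma qPoch_self_ne_zero {q : ℂ} (hq1 : ‖q‖ < 1) (n : ℕ) : qPoch q q n ≠ 0 :=
  prod_ne_zero_iff.mpr fun j _ => by
    rw [← pow_succ']
    exact one_sub_pow_ne_zero hq1 j.succ_ne_zero

lemma norm_sq_lt_one {q : ℂ} (hq1 : ‖q‖ < 1) : ‖q ^ 2‖ < 1 := by
  rw [norm_pow]
  exact pow_lt_one₀ (norm_nonneg q) hq1 two_ne_zero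

/-- `1 / (q;q)_{n-k}`, extended by zero to `k > n`. -/
noncomputable def qPochSelfInv (q : ℂ) (n k : ℕ) : ℂ :=
  if k ≤ n then (qPoch q q (n - k))⁻¹ else 0

lemma qPochSelfInv_of_lt (q : ℂ) {n k : ℕ} (h : n < k) : qPochSelfInv q n k = 0 :=
  if_neg (not_le.mpr h)

lemma qPochSelfInv_succ_succ (q : ℂ) (n k : ℕ) :
    qPochSelfInv q (n + 1) (k + 1) = qPochSelfInv q n k := by
  simp [qPochSelfInv]

lemma pow_mul_qPochSelfInv {q : ℂ} (hq1 : ‖q‖ < 1) (n k : ℕ) :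
    q ^ k * qPochSelfInv q n k = qPochSelfInv q (n + 1) k * (q ^ k - q ^ (n + 1)) := by
  rcases lt_trichotomy k (n + 1) with h | rfl | h
  · obtain ⟨m, rfl⟩ := Nat.exists_eq_add_of_le (Nat.lt_succ_iff.mp h)
    have e : k + m + 1 - k = m + 1 := by omega
    have h1 := qPoch_self_ne_zero hq1 m
    have h2 : 1 - q * q ^ m ≠ 0 := by
      rw [← pow_succ']
      exact one_sub_pow_ne_zero hq1 m.succ_ne_zero
    simp only [qPochSelfInv, Nat.le_add_right, if_true, h.le, e, qPoch_succ,
      Nat.add_sub_cancel_left]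
    field_simp
    ring
  · simp [qPochSelfInv_of_lt]
  · simp [qPochSelfInv_of_lt _ h, qPochSelfInv_of_lt _ ((Nat.lt_succ_self n).trans h)]

/-- The part of the base change summand that does not depend on the upper limit. -/
noncomputable def baseChangeCoeff (q b : ℂ) (k : ℕ) : ℂ :=
  qPoch q (-(b * q)) (2 * k) / (qPoch (q ^ 2) (q ^ 2) k * qPoch (q ^ 2) (b ^ 2 * q ^ 2) k)

lemma baseChangeCoeff_succ {q b : ℂ} (hq1 : ‖q‖ < 1)
    (hb : ∀ m : ℕ, 1 - b ^ 2 * q ^ 2 * (q ^ 2) ^ m ≠ 0) (k : ℕ) :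
    (1 - (q ^ 2) ^ (k + 1)) * (1 - b ^ 2 * (q ^ 2) ^ (k + 1)) * baseChangeCoeff q b (k + 1) =
      (1 + b * q * (q ^ 2) ^ k) * (1 + b * q ^ 2 * (q ^ 2) ^ k) * baseChangeCoeff q b k := by
  have h1 := qPoch_self_ne_zero (norm_sq_lt_one hq1) k
  have h2 : qPoch (q ^ 2) (b ^ 2 * q ^ 2) k ≠ 0 := prod_ne_zero_iff.mpr fun j _ => hb j
  have h3 := one_sub_pow_ne_zero (norm_sq_lt_one hq1) k.succ_ne_zero
  have h4 := hb k
  rw [Nat.succ_eq_add_one, pow_succ'] at h3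
  rw [baseChangeCoeff, baseChangeCoeff, mul_add, mul_one, qPoch_succ, qPoch_succ, qPoch_succ,
    qPoch_succ, pow_succ q (2 * k), pow_mul, pow_succ' (q ^ 2), ← mul_assoc (b ^ 2)]
  generalize (q ^ 2) ^ k = x at *
  generalize qPoch (q ^ 2) (b ^ 2 * q ^ 2) k = Q at *
  have h5 : 1 - q ^ 2 * x * b ^ 2 ≠ 0 := by convert h4 using 2; ring
  field_simp
  ring

/-- The summand `(-bq;q)_{2k} q^{n-k} / ((q²;q²)_{n-k} (q²;q²)_k (b²q²;q²)_k)`. -/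
noncomputable def baseChangeTerm (q b : ℂ) (n k : ℕ) : ℂ :=
  qPochSelfInv (q ^ 2) n k * (q ^ n / q ^ k) * baseChangeCoeff q b k

/-- The telescoping certificate for the recurrence in the upper limit. -/
noncomputable def baseChangeCert (q b : ℂ) (n k : ℕ) : ℂ :=
  -(q ^ 4 * (q ^ 2) ^ n / (q ^ 2) ^ k) * (1 - (q ^ 2) ^ k) * (1 - b ^ 2 * (q ^ 2) ^ k) *
    baseChangeTerm q b (n + 2) k

lemma baseChangeTerm_telescope {q b : ℂ} (hq0 : q ≠ 0) (hq1 : ‖q‖ < 1)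
    (hb : ∀ m : ℕ, 1 - b ^ 2 * q ^ 2 * (q ^ 2) ^ m ≠ 0) (n k : ℕ) :
    (1 - q ^ 4 * (q ^ 2) ^ n) * (1 - b ^ 2 * q ^ 4 * (q ^ 2) ^ n) * baseChangeTerm q b (n + 2) k
      - (1 + q) * (1 + b * q ^ 3 * (q ^ 2) ^ n) * baseChangeTerm q b (n + 1) k
      + q * baseChangeTerm q b n k = baseChangeCert q b n (k + 1) - baseChangeCert q b n k := by
  have hA := baseChangeCoeff_succ hq1 hb k
  have e1 := pow_mul_qPochSelfInv (norm_sq_lt_one hq1) (n + 1) k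
  have e0 := pow_mul_qPochSelfInv (norm_sq_lt_one hq1) n k
  have hx : (q ^ 2) ^ k ≠ 0 := pow_ne_zero _ (pow_ne_zero _ hq0)
  have hxk : q ^ k ≠ 0 := pow_ne_zero _ hq0
  have hc : baseChangeCert q b n (k + 1) =
      -(q ^ 4 * (q ^ 2) ^ n / (q ^ 2) ^ (k + 1)) * (qPochSelfInv (q ^ 2) (n + 1) k *
        (q ^ (n + 2) / q ^ (k + 1))) * ((1 - (q ^ 2) ^ (k + 1)) *
        (1 - b ^ 2 * (q ^ 2) ^ (k + 1)) * baseChangeCoeff q b (k + 1)) := by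
    rw [baseChangeCert, baseChangeTerm, qPochSelfInv_succ_succ]
    ring
  rw [hc, hA, baseChangeCert]
  simp only [baseChangeTerm]
  rw [mul_comm, ← eq_div_iff hx] at e1 e0
  rw [e0, e1]
  simp only [pow_succ (q ^ 2), pow_succ q n, pow_succ q k, pow_add q n 2]
  generalize (q ^ 2) ^ k = x at *
  generalize (q ^ 2) ^ n = y at *
  field_simp
  ring

lemma sum_baseChangeTerm_recurrence {q b : ℂ} (hq0 : q ≠ 0) (hq1 : ‖q‖ < 1)
    (hb : ∀ m : ℕ, 1 - b ^ 2 * q ^ 2 * (q ^ 2) ^ m ≠ 0) (n : ℕ) :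
    (1 - q ^ 4 * (q ^ 2) ^ n) * (1 - b ^ 2 * q ^ 4 * (q ^ 2) ^ n) *
        ∑ k ∈ range (n + 3), baseChangeTerm q b (n + 2) k
      - (1 + q) * (1 + b * q ^ 3 * (q ^ 2) ^ n) * ∑ k ∈ range (n + 2), baseChangeTerm q b (n + 1) k
      + q * ∑ k ∈ range (n + 1), baseChangeTerm q b n k = 0 := by
  have hz : ∀ {m k : ℕ}, m < k → baseChangeTerm q b m k = 0 := fun h => by
    simp [baseChangeTerm, qPochSelfInv_of_lt _ h]
  have h1 : ∑ k ∈ range (n + 2), baseChangeTerm q b (n + 1) k =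
      ∑ k ∈ range (n + 3), baseChangeTerm q b (n + 1) k := by
    rw [sum_range_succ _ (n + 2), hz (by omega), add_zero]
  have h0 : ∑ k ∈ range (n + 1), baseChangeTerm q b n k =
      ∑ k ∈ range (n + 3), baseChangeTerm q b n k := by
    rw [sum_range_succ _ (n + 2), sum_range_succ _ (n + 1), hz (by omega), hz (by omega),
      add_zero, add_zero]
  rw [h1, h0, mul_sum, mul_sum, mul_sum, ← sum_sub_distrib, ← sum_add_distrib,
    sum_congr rfl fun k _ => baseChangeTerm_telescope hq0 hq1 hb n k, sum_range_sub]
  simp [baseChangeCert, hz (Nat.lt_succ_self (n + 2))]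

theorem sum_baseChangeTerm {q b : ℂ} (hq0 : q ≠ 0) (hq1 : ‖q‖ < 1)
    (hb : ∀ m : ℕ, 1 - b ^ 2 * q ^ 2 * (q ^ 2) ^ m ≠ 0) (n : ℕ) :
    ∑ k ∈ range (n + 1), baseChangeTerm q b n k = (qPoch q q n * qPoch q (b * q) n)⁻¹ := by
  have hbn : ∀ m : ℕ, 1 - b * q * q ^ m ≠ 0 := fun m h => hb m <| by
    linear_combination (1 + b * q * q ^ m) * h
  have hqn : ∀ m : ℕ, 1 - q * q ^ m ≠ 0 := fun m => by
    rw [← pow_succ']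
    exact one_sub_pow_ne_zero hq1 m.succ_ne_zero
  induction n using Nat.twoStepInduction with
  | zero => simp [baseChangeTerm, baseChangeCoeff, qPochSelfInv, qPoch]
  | one =>
    have h1 := hb 0
    have h2 := hbn 0
    have h3 := hqn 0
    have h4 := one_sub_pow_ne_zero hq1 two_ne_zero
    simp only [pow_zero, mul_one] at h1 h2 h3
    simp [baseChangeTerm, baseChangeCoeff, qPochSelfInv, qPoch, sum_range_succ, prod_range_succ]
    rw [mul_comm] at h1 h2
    field_simp
    ring
  | more n ih0 ih1 =>
    have hrec := sum_baseChangeTerm_recurrence hq0 hq1 hb n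
    rw [ih0, ih1] at hrec
    have hP := qPoch_self_ne_zero hq1 n
    have hQ : qPoch q (b * q) n ≠ 0 := prod_ne_zero_iff.mpr fun j _ => hbn j
    have u1 := hqn n
    have u2 := hqn (n + 1)
    have v1 := hbn n
    have v2 := hbn (n + 1)
    have w1 : 1 - q ^ 4 * (q ^ 2) ^ n ≠ 0 := by
      have := one_sub_pow_ne_zero (norm_sq_lt_one hq1) (n + 1).add_one_ne_zero
      convert this using 2
      ring
    have w2 : 1 - b ^ 2 * q ^ 4 * (q ^ 2) ^ n ≠ 0 := by
      convert hb (n + 1) using 2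
      ring
    refine mul_left_cancel₀ (mul_ne_zero w1 w2) ?_
    rw [sub_add, sub_eq_zero] at hrec
    rw [hrec]
    simp only [qPoch_succ]
    simp only [← pow_mul, mul_comm 2 n]
    simp only [pow_mul, pow_succ q n] at u2 v2 ⊢
    generalize q ^ n = y at *
    generalize qPoch q (b * q) n = Q at *
    rw [mul_comm b q] at v1 v2
    have u3 : 1 - q ^ 2 * y ≠ 0 := by convert u2 using 2; ring
    have v3 : 1 - q ^ 2 * b * y ≠ 0 := by convert v2 using 2; ring
    field_simp
    ring

lemma sum_baseChange_shifted {q a : ℂ} (hq0 : q ≠ 0) (hq1 : ‖q‖ < 1)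
    (haq2 : ∀ m : ℕ, qPoch (q ^ 2) (a ^ 2 * q ^ 2) m ≠ 0) (s n : ℕ) :
    ∑ k ∈ range (n + 1), qPoch q (-(a * q)) (2 * (s + k)) * q ^ (n - k) /
        (qPoch (q ^ 2) (q ^ 2) (n - k) * (qPoch (q ^ 2) (q ^ 2) k *
          qPoch (q ^ 2) (a ^ 2 * q ^ 2) (2 * s + k))) =
      (qPoch q q n * qPoch q (a * q) (2 * s + n))⁻¹ := by
  have hb : ∀ m : ℕ, 1 - (a * q ^ (2 * s)) ^ 2 * q ^ 2 * (q ^ 2) ^ m ≠ 0 := fun m => by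
    have := haq2 (2 * s + m + 1)
    rw [qPoch_succ] at this
    convert right_ne_zero_of_mul this using 2
    ring
  have hsq : qPoch (q ^ 2) (a ^ 2 * q ^ 2) (2 * s) =
      qPoch q (a * q) (2 * s) * qPoch q (-(a * q)) (2 * s) := by
    rw [← qPoch_sq, mul_pow]
  have hne := haq2 (2 * s)
  rw [hsq] at hne
  have hne1 := left_ne_zero_of_mul hne
  have hne2 := right_ne_zero_of_mul hne
  have e1 : a * q * q ^ (2 * s) = a * q ^ (2 * s) * q := by ring
  rw [qPoch_add q (a * q), e1, mul_left_comm, mul_inv, ← sum_baseChangeTerm hq0 hq1 hb n, mul_sum]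
  refine sum_congr rfl fun k hk => ?_
  have hk : k ≤ n := Nat.lt_succ_iff.mp (mem_range.mp hk)
  have e2 : -(a * q) * q ^ (2 * s) = -(a * q ^ (2 * s) * q) := by ring
  have e3 : a ^ 2 * q ^ 2 * (q ^ 2) ^ (2 * s) = (a * q ^ (2 * s)) ^ 2 * q ^ 2 := by ring
  rw [mul_add, qPoch_add q, qPoch_add (q ^ 2) (a ^ 2 * q ^ 2), hsq, e2, e3, baseChangeTerm,
    baseChangeCoeff, qPochSelfInv, if_pos hk, pow_sub₀ q hq0 hk]
  field_simp

/-- Bressoud–Ismail–Stanton base change: a Bailey pair relative to `(a², q²)` yields a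
Bailey pair relative to `(a, q)`. -/
theorem bailey_base_change (q a : ℂ) (hq0 : 0 < ‖q‖) (hq1 : ‖q‖ < 1)
    (haq2 : ∀ m : ℕ, qPoch (q ^ 2) (a ^ 2 * q ^ 2) m ≠ 0)
    (haq : ∀ m : ℕ, qPoch q (a * q) m ≠ 0)
    (α β : ℕ → ℂ) (hpair : IsBaileyPair (q ^ 2) (a ^ 2) α β) :
    IsBaileyPair q a
      (fun n => α n)
      (fun n => ∑ r ∈ Finset.range (n + 1),
        qPoch q (-(a * q)) (2 * r) * q ^ (n - r) * β r / qPoch (q ^ 2) (q ^ 2) (n - r)) := by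
  intro n
  simp only [hpair _, mul_sum, sum_div]
  rw [sum_comm' (t' := range (n + 1)) (s' := fun s => Ico s (n + 1))
    (by intro r s; simp only [mem_range, mem_Ico]; omega)]
  refine sum_congr rfl fun s hs => ?_
  obtain ⟨m, rfl⟩ := Nat.exists_eq_add_of_le (Nat.lt_succ_iff.mp (mem_range.mp hs))
  have e1 : s + m - s = m := by omega
  have e2 : s + m + s = 2 * s + m := by omega
  have e3 : s + m + 1 - s = m + 1 := by omega
  rw [sum_Ico_eq_sum_range, e1, e2, e3, div_eq_mul_inv,
    ← sum_baseChange_shifted (norm_pos_iff.mp hq0) hq1 haq2, mul_sum]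
  refine sum_congr rfl fun k _ => ?_
  have e4 : s + m - (s + k) = m - k := by omega
  have e5 : s + k - s = k := by omega
  have e6 : s + k + s = 2 * s + k := by omega
  rw [e4, e5, e6]
  simp only [div_eq_mul_inv, mul_inv]
  ring
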